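/- arXiv:1703.08149 — 2 statements merged into one kernel-verified Lean document; each statement's English description precedes it below -/
import Mathlib

section
/- Let α > 0. Then there exist constants α₀ > 0 and C > 0 such that for every ρ > 1, G^α_{1/2}(ρ) ≤ C e^{−(3+α₀)ρ}. -/
open MeasureTheory Real

noncomputable section

/-- The kernel of `(-Δ_ℍ + α)^{-1/2}` on 4-dimensional hyperbolic space, as a
function of the geodesic distance `ρ`. -/
def Gahalf (α ρ : ℝ) : ℝ :=
  (1 / (2 * Real.sqrt π * (2 * π) ^ ((5 : ℝ) / 2))) *
      (∫ r in Set.Ioi ρ,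
        ((r * Real.cosh r - Real.sinh r) /
            (Real.sinh r ^ 2 * Real.sqrt (Real.cosh r - Real.cosh ρ))) *
          ∫ t in Set.Ioi (0 : ℝ), t ^ (-2 : ℤ) * Real.exp (-(α + 9 / 4) * t - r ^ 2 / (4 * t)))
    + (1 / (4 * Real.sqrt π * (2 * π) ^ ((5 : ℝ) / 2))) *
      (∫ r in Set.Ioi ρ,
        (r ^ 2 / (Real.sinh r * Real.sqrt (Real.cosh r - Real.cosh ρ))) *
          ∫ t in Set.Ioi (0 : ℝ), t ^ (-3 : ℤ) * Real.exp (-(α + 9 / 4) * t - r ^ 2 / (4 * t)))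

end

/-- An upper bound for a set integral that needs no integrability of the smaller function. -/
lemma setIntegral_le_of_forall_le {f g : ℝ → ℝ} {s : Set ℝ} (hs : MeasurableSet s)
    (hg : IntegrableOn g s) (hg0 : ∀ x ∈ s, 0 ≤ g x) (hfg : ∀ x ∈ s, f x ≤ g x) :
    ∫ x in s, f x ≤ ∫ x in s, g x := by
  by_cases hf : IntegrableOn f s
  · exact setIntegral_mono_on hf hg hs hfg
  · rw [integral_undef hf]
    exact setIntegral_nonneg hs hg0

lemma neg_sq_mul_sub_le {s d r t : ℝ} (hd : 0 < d) (hds : d < s) (hr : 1 ≤ r) (ht : 0 < t) :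
    -s ^ 2 * t - r ^ 2 / (4 * t) ≤ -(s - d) * r + (-(d / (4 * s)) / t + -(d * s) * t) := by
  have hs : 0 < s := hd.trans hds
  have hid : s ^ 2 * t + r ^ 2 / (4 * t) - (s - d) * r - d / (4 * s) / t - d * s * t
      = (s - d) / s * ((s * t - r / 2) ^ 2 / t) + d * (r ^ 2 - 1) / (4 * s * t) := by
    field_simp
    ring
  have h1 : 0 ≤ (s - d) / s * ((s * t - r / 2) ^ 2 / t) :=
    mul_nonneg (div_nonneg (by linarith) hs.le) (by positivity)
  have h2 : 0 ≤ d * (r ^ 2 - 1) / (4 * s * t) :=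
    div_nonneg (mul_nonneg hd.le (by nlinarith)) (by positivity)
  have h3 : -(d / (4 * s)) / t = -(d / (4 * s) / t) := neg_div _ _
  rw [h3]
  linarith

lemma zpow_neg_mul_exp_neg_div_le {b t : ℝ} (hb : 0 < b) (ht : 0 < t) (k : ℕ) :
    t ^ (-(k : ℤ)) * exp (-b / t) ≤ k.factorial / b ^ k := by
  have h := pow_div_factorial_le_exp (b / t) (by positivity) k
  have hk : (0 : ℝ) < k.factorial := by positivity
  rw [div_le_iff₀ hk, div_pow] at h
  rw [neg_div, exp_neg, zpow_neg, zpow_natCast, ← mul_inv, inv_eq_one_div,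
    div_le_div_iff₀ (by positivity) (by positivity)]
  rw [div_le_iff₀ (by positivity)] at h
  linarith

/-- The time integral decays exponentially in `r`, at any rate smaller than `s`. -/
lemma integral_zpow_mul_exp_le {s d : ℝ} (hd : 0 < d) (hds : d < s) (k : ℕ) :
    ∃ A : ℝ, 0 < A ∧ ∀ r : ℝ, 1 ≤ r →
      ∫ t in Set.Ioi (0 : ℝ), t ^ (-(k : ℤ)) * exp (-s ^ 2 * t - r ^ 2 / (4 * t))
        ≤ A * exp (-(s - d) * r) := by
  have hs : 0 < s := hd.trans hds
  have hb : 0 < d / (4 * s) := by positivity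
  set M : ℝ := k.factorial / (d / (4 * s)) ^ k with hM
  have hM0 : 0 < M := by positivity
  have hneg : -(d * s) < 0 := by nlinarith
  refine ⟨M / (d * s), by positivity, fun r hr ↦ ?_⟩
  calc
    _ ≤ ∫ t in Set.Ioi (0 : ℝ), M * exp (-(s - d) * r) * exp (-(d * s) * t) := by
      refine setIntegral_le_of_forall_le measurableSet_Ioi
        ((integrableOn_exp_mul_Ioi hneg 0).const_mul _) (fun t _ ↦ by positivity) fun t ht ↦ ?_
      have ht : 0 < t := ht
      have h1 := exp_le_exp.2 (neg_sq_mul_sub_le hd hds hr ht)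
      rw [exp_add, exp_add] at h1
      have h2 := zpow_neg_mul_exp_neg_div_le hb ht k
      calc
        _ ≤ t ^ (-(k : ℤ)) * (exp (-(s - d) * r) *
              (exp (-(d / (4 * s)) / t) * exp (-(d * s) * t))) := by gcongr
        _ = t ^ (-(k : ℤ)) * exp (-(d / (4 * s)) / t) *
              (exp (-(s - d) * r) * exp (-(d * s) * t)) := by ring
        _ ≤ M * (exp (-(s - d) * r) * exp (-(d * s) * t)) := by gcongr
        _ = _ := by ring
    _ = _ := by
      rw [integral_const_mul, integral_exp_mul_Ioi hneg]
      simp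
      field_simp

lemma exp_div_four_le_sinh {r : ℝ} (hr : 1 ≤ r) : exp r / 4 ≤ sinh r := by
  have h1 : 2 ≤ exp r := by linarith [add_one_le_exp r]
  have h2 : exp (-r) ≤ 1 := exp_le_one_iff.2 (by linarith)
  rw [sinh_eq]
  linarith

lemma exp_div_four_mul_sub_le_cosh_sub_cosh {r ρ : ℝ} (hρ : 1 ≤ ρ) (hr : ρ ≤ r) :
    exp ρ / 4 * (r - ρ) ≤ cosh r - cosh ρ := by
  have h1 : r - ρ ≤ sinh (r - ρ) := self_le_sinh_iff.2 (by linarith)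
  have h2 : 1 ≤ cosh (r - ρ) := one_le_cosh _
  have h3 : cosh r = cosh ρ * cosh (r - ρ) + sinh ρ * sinh (r - ρ) := by
    rw [← cosh_add]; ring_nf
  have h4 := exp_div_four_le_sinh hρ
  have h5 : 0 < exp ρ := exp_pos ρ
  have h6 : exp ρ / 4 * (r - ρ) ≤ sinh ρ * sinh (r - ρ) := by
    gcongr
  nlinarith [cosh_pos ρ]

lemma inv_sqrt_cosh_sub_cosh_le {r ρ : ℝ} (hρ : 1 ≤ ρ) (hr : ρ < r) :
    (√(cosh r - cosh ρ))⁻¹ ≤ 2 * exp (-(1 / 2) * ρ) * (r - ρ) ^ (-(1 / 2) : ℝ) := by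
  have h := exp_div_four_mul_sub_le_cosh_sub_cosh hρ hr.le
  have hr' : 0 < r - ρ := by linarith
  have he : exp ρ / 4 * (r - ρ) = (exp ((1 / 2) * ρ) / 2 * √(r - ρ)) ^ 2 := by
    rw [mul_pow, sq_sqrt hr'.le, div_pow, ← exp_nat_mul,
      show ((2 : ℕ) : ℝ) * (1 / 2 * ρ) = ρ by push_cast; ring]
    norm_num
  have h1 : exp ((1 / 2) * ρ) / 2 * √(r - ρ) ≤ √(cosh r - cosh ρ) :=
    le_sqrt_of_sq_le (he ▸ h)
  have h2 : 0 < √(r - ρ) := sqrt_pos.2 hr'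
  have h3 : (r - ρ) ^ (-(1 / 2) : ℝ) = (√(r - ρ))⁻¹ := by
    rw [rpow_neg hr'.le, sqrt_eq_rpow]
  calc
    _ ≤ (exp ((1 / 2) * ρ) / 2 * √(r - ρ))⁻¹ := inv_anti₀ (by positivity) h1
    _ = _ := by
      rw [h3, neg_mul, exp_neg]
      field_simp

lemma integrableOn_exp_mul_sub_rpow {l : ℝ} (hl : 0 < l) (ρ : ℝ) :
    IntegrableOn (fun r ↦ exp (-l * (r - ρ)) * (r - ρ) ^ (-(1 / 2) : ℝ)) (Set.Ioi ρ) ∧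
    ∫ r in Set.Ioi ρ, exp (-l * (r - ρ)) * (r - ρ) ^ (-(1 / 2) : ℝ)
      = ∫ u in Set.Ioi (0 : ℝ), exp (-l * u) * u ^ (-(1 / 2) : ℝ) := by
  have h0 : IntegrableOn (fun u : ℝ ↦ exp (-l * u) * u ^ (-(1 / 2) : ℝ)) (Set.Ioi 0) := by
    have := integrableOn_rpow_mul_exp_neg_mul_rpow (s := -(1 / 2)) (p := 1) (b := l)
      (by norm_num) (by norm_num) hl
    refine this.congr_fun (fun u _ ↦ ?_) measurableSet_Ioi
    simp only [rpow_one]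
    ring
  have hm := measurePreserving_sub_right (volume : Measure ℝ) ρ
  have he : MeasurableEmbedding (fun r : ℝ ↦ r - ρ) :=
    (MeasurableEquiv.subRight ρ).measurableEmbedding
  have hpre : (fun r : ℝ ↦ r - ρ) ⁻¹' Set.Ioi 0 = Set.Ioi ρ := by
    ext r; simp
  constructor
  · rw [← hpre]
    exact (hm.integrableOn_comp_preimage he).2 h0
  · rw [← hpre]
    exact hm.setIntegral_preimage_emb he (fun u ↦ exp (-l * u) * u ^ (-(1 / 2) : ℝ)) _

lemma setIntegral_Ioi_le_exp_neg_mul {l : ℝ} (hl : 0 < l) :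
    ∃ B : ℝ, 0 ≤ B ∧ ∀ (ρ K : ℝ) (F : ℝ → ℝ), 0 ≤ K →
      (∀ r, ρ < r → F r ≤ K * (exp (-l * r) * (r - ρ) ^ (-(1 / 2) : ℝ))) →
      ∫ r in Set.Ioi ρ, F r ≤ B * K * exp (-l * ρ) := by
  refine ⟨∫ u in Set.Ioi (0 : ℝ), exp (-l * u) * u ^ (-(1 / 2) : ℝ),
    setIntegral_nonneg measurableSet_Ioi fun u hu ↦
      mul_nonneg (exp_pos _).le (rpow_nonneg (le_of_lt hu) _), fun ρ K F hK hF ↦ ?_⟩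
  obtain ⟨hint, heq⟩ := integrableOn_exp_mul_sub_rpow hl ρ
  rw [← heq]
  calc
    _ ≤ ∫ r in Set.Ioi ρ,
          K * exp (-l * ρ) * (exp (-l * (r - ρ)) * (r - ρ) ^ (-(1 / 2) : ℝ)) := by
      refine setIntegral_le_of_forall_le measurableSet_Ioi (hint.const_mul _)
        (fun r hr ↦ ?_) fun r hr ↦ (hF r hr).trans_eq ?_
      · have : 0 ≤ r - ρ := sub_nonneg.2 (le_of_lt hr)
        positivity
      · rw [show -l * r = -l * ρ + -l * (r - ρ) by ring, exp_add]
        ring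
    _ = _ := by
      rw [integral_const_mul]
      ring

lemma sq_le_mul_exp {d r : ℝ} (hd : 0 < d) (hr : 0 ≤ r) : r ^ 2 ≤ 2 / d ^ 2 * exp (d * r) := by
  have h := pow_div_factorial_le_exp (d * r) (by positivity) 2
  rw [div_mul_eq_mul_div, le_div_iff₀ (by positivity)]
  norm_num at h
  nlinarith

lemma mul_cosh_sub_sinh_div_le {r : ℝ} (hr : 1 ≤ r) :
    (r * cosh r - sinh r) / sinh r ^ 2 ≤ 16 * r ^ 2 * exp (-r) := by
  have h1 := exp_div_four_le_sinh hr
  have h2 : 0 < exp r := exp_pos r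
  have h3 : cosh r ≤ exp r := by
    rw [← cosh_add_sinh]
    linarith
  calc
    _ ≤ (r ^ 2 * exp r) / (exp r / 4) ^ 2 := by
      have h4 : r * cosh r ≤ r ^ 2 * exp r := by
        gcongr
        nlinarith
      gcongr
      linarith
    _ = _ := by
      rw [exp_neg]
      field_simp
      norm_num

lemma sq_div_sinh_le {r : ℝ} (hr : 1 ≤ r) : r ^ 2 / sinh r ≤ 16 * r ^ 2 * exp (-r) := by
  have h1 := exp_div_four_le_sinh hr
  have h2 : 0 < exp r := exp_pos r
  calc
    _ ≤ r ^ 2 / (exp r / 16) := by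
      gcongr
      linarith
    _ = _ := by
      rw [exp_neg]
      field_simp

/-- Decay of the spatial integral against a weight `w` of size `r ^ 2 * exp (-r)`. -/
lemma exists_integral_le_exp_neg {s d : ℝ} (hd : 0 < d) (hs : s = 3 / 2 + 3 * d) {w : ℝ → ℝ}
    (hw : ∀ r, 1 ≤ r → w r ≤ 16 * r ^ 2 * exp (-r)) (k : ℕ) :
    ∃ C : ℝ, 0 ≤ C ∧ ∀ ρ : ℝ, 1 < ρ →
      ∫ r in Set.Ioi ρ, w r * (√(cosh r - cosh ρ))⁻¹ *
        (∫ t in Set.Ioi (0 : ℝ), t ^ (-(k : ℤ)) * exp (-s ^ 2 * t - r ^ 2 / (4 * t)))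
        ≤ C * exp (-(3 + d) * ρ) := by
  obtain ⟨A, hA, hJ⟩ := integral_zpow_mul_exp_le hd (by linarith : d < s) k
  obtain ⟨B, hB, hI⟩ := setIntegral_Ioi_le_exp_neg_mul (by linarith : 0 < 5 / 2 + d)
  refine ⟨B * (64 * A / d ^ 2), by positivity, fun ρ hρ ↦ ?_⟩
  refine (hI ρ (64 * A / d ^ 2 * exp (-(1 / 2) * ρ)) _ (by positivity) fun r hr ↦ ?_).trans_eq ?_
  · have hr1 : 1 ≤ r := by linarith
    have hrρ : 0 < r - ρ := by linarith
    have hJ0 : 0 ≤ ∫ t in Set.Ioi (0 : ℝ),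
        t ^ (-(k : ℤ)) * exp (-s ^ 2 * t - r ^ 2 / (4 * t)) :=
      setIntegral_nonneg measurableSet_Ioi fun t ht ↦
        mul_nonneg (zpow_nonneg (le_of_lt ht) _) (exp_pos _).le
    have hq := sq_le_mul_exp hd (by linarith : 0 ≤ r)
    have hw' : w r ≤ 16 * (2 / d ^ 2 * exp (d * r)) * exp (-r) := (hw r hr1).trans (by gcongr)
    calc
      _ ≤ 16 * (2 / d ^ 2 * exp (d * r)) * exp (-r) *
            (2 * exp (-(1 / 2) * ρ) * (r - ρ) ^ (-(1 / 2) : ℝ)) * (A * exp (-(s - d) * r)) := by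
        have := inv_sqrt_cosh_sub_cosh_le hρ.le hr
        have := hJ r hr1
        gcongr
      _ = _ := by
        have he : exp (-(5 / 2 + d) * r) = exp (d * r) * exp (-r) * exp (-(s - d) * r) := by
          rw [← exp_add, ← exp_add, hs]
          ring_nf
        rw [he]
        ring
  · rw [show -(3 + d) * ρ = -(1 / 2) * ρ + -(5 / 2 + d) * ρ by ring, exp_add]
    ring

theorem Gahalf_decay (α : ℝ) (hα : 0 < α) :
    ∃ α₀ C : ℝ, 0 < α₀ ∧ 0 < C ∧ ∀ ρ : ℝ, 1 < ρ →
      Gahalf α ρ ≤ C * Real.exp (-(3 + α₀) * ρ) := by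
  obtain ⟨d, hdef⟩ : ∃ d : ℝ, √(α + 9 / 4) = 3 / 2 + 3 * d :=
    ⟨(√(α + 9 / 4) - 3 / 2) / 3, by ring⟩
  have hsq : (3 / 2 + 3 * d) ^ 2 = α + 9 / 4 := by
    rw [← hdef, sq_sqrt (by linarith)]
  have hd : 0 < d := by
    have : 3 / 2 < √(α + 9 / 4) := lt_sqrt_of_sq_lt (by norm_num [hα])
    linarith
  obtain ⟨C₁, hC₁, h₁⟩ := exists_integral_le_exp_neg hd rfl
    (fun r hr ↦ mul_cosh_sub_sinh_div_le hr) 2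
  obtain ⟨C₂, hC₂, h₂⟩ := exists_integral_le_exp_neg hd rfl (fun r hr ↦ sq_div_sinh_le hr) 3
  rw [hsq] at h₁ h₂
  set a : ℝ := 1 / (2 * √π * (2 * π) ^ ((5 : ℝ) / 2)) with ha
  set b : ℝ := 1 / (4 * √π * (2 * π) ^ ((5 : ℝ) / 2)) with hb
  have ha0 : 0 ≤ a := by positivity
  have hb0 : 0 ≤ b := by positivity
  refine ⟨d, a * C₁ + b * C₂ + 1, hd, by positivity, fun ρ hρ ↦ ?_⟩
  have e₁ := mul_le_mul_of_nonneg_left (h₁ ρ hρ) ha0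
  have e₂ := mul_le_mul_of_nonneg_left (h₂ ρ hρ) hb0
  have e₃ := exp_pos (-(3 + d) * ρ)
  simp only [← div_eq_mul_inv, div_div, Nat.cast_ofNat] at e₁ e₂
  unfold Gahalf
  rw [← ha, ← hb]
  linarith
end

section
/- There exists a constant A₁ > 0 (one may take A₁ = 2^{1/4} π^{−1/2}) such that for every t > 0, the non-increasing rearrangement of the function x ↦ G₁(ρ(x)) on B⁴ with respect to hyperbolic volume satisfies [G₁(ρ(·))]*(t) ≤ (1/(4√2 π √t)) · (1 + A₁ t^{1/4}). -/
open MeasureTheory Real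

noncomputable section

/-- The Euclidean space `ℝ⁴`. -/
abbrev E4 := EuclideanSpace ℝ (Fin 4)

/-- The hyperbolic volume measure on the Poincaré ball `B⁴`: Lebesgue measure restricted
to the unit ball, with density `(2/(1-|x|²))⁴`. -/
def hypVol : Measure E4 :=
  (volume.restrict (Metric.ball (0 : E4) 1)).withDensity
    (fun x => ENNReal.ofReal ((2 / (1 - ‖x‖ ^ 2)) ^ 4))

/-- The hyperbolic distance from the origin in the Poincaré ball. -/
def rhyp (x : E4) : ℝ := Real.log ((1 + ‖x‖) / (1 - ‖x‖))

/-- The non-increasing rearrangement of a function on `B⁴` with respect to the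
hyperbolic volume. -/
def rearr (f : E4 → ℝ) (t : ℝ) : ℝ :=
  sInf {s : ℝ | 0 < s ∧ hypVol {x : E4 | s < |f x|} ≤ ENNReal.ofReal t}

end
noncomputable section

/-- The Green's function kernel of `-Δ_ℍ - 9/4` on 4-dimensional hyperbolic space. -/
def G1 (ρ : ℝ) : ℝ :=
  (1 / (4 * Real.sqrt 2 * π ^ 2)) *
    ∫ r in Set.Ioi ρ,
      Real.cosh r / (Real.sinh r ^ 2 * Real.sqrt (Real.cosh r - Real.cosh ρ))

end

open Filter Topology Set

lemma Real.tendsto_cosh_atTop_atTop : Tendsto Real.cosh atTop atTop := by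
  refine tendsto_atTop_mono (f := fun x => Real.exp x / 2) (fun x => ?_)
    (Real.tendsto_exp_atTop.atTop_div_const (by norm_num))
  rw [Real.cosh_eq]
  have := Real.exp_pos (-x)
  linarith

lemma hasDerivAt_sqrt_one_sub_div_cosh {a r : ℝ} (ha : 0 < a) (hr : a < cosh r - 1) :
    HasDerivAt (fun r => 2 / a * √(1 - a / (cosh r - 1)))
      (sinh r / ((cosh r - 1) * (√(cosh r - 1) * √(cosh r - 1 - a)))) r := by
  have hw : 0 < cosh r - 1 := ha.trans hr
  have hs : 0 < cosh r - 1 - a := by linarith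
  have h1 : 1 - a / (cosh r - 1) = (cosh r - 1 - a) / (cosh r - 1) := by field_simp
  have hne : 1 - a / (cosh r - 1) ≠ 0 := by rw [h1]; positivity
  have hd := (((hasDerivAt_const r a).div ((hasDerivAt_cosh r).sub_const 1) hw.ne').const_sub
    1).sqrt hne |>.const_mul (2 / a)
  refine hd.congr_deriv ?_
  simp only [Pi.div_apply]
  rw [h1, Real.sqrt_div hs.le]
  have e1 := Real.sq_sqrt hw.le
  have p1 := Real.sqrt_pos.2 hw
  have p2 := Real.sqrt_pos.2 hs
  generalize √(cosh r - 1) = w at *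
  rw [← e1]
  field_simp
  ring

lemma hasDerivAt_arctan_sqrt_cosh {a r : ℝ} (ha : 0 < a) (hr : a < cosh r - 1) :
    HasDerivAt (fun r => 2 / √a * arctan √((cosh r - 1 - a) / a))
      (sinh r / ((cosh r - 1) * √(cosh r - 1 - a))) r := by
  have hw : 0 < cosh r - 1 := ha.trans hr
  have hs : 0 < cosh r - 1 - a := by linarith
  have hne : (cosh r - 1 - a) / a ≠ 0 := by positivity
  have hd := (((((hasDerivAt_cosh r).sub_const 1).sub_const a).div_const a).sqrt hne).arctan
    |>.const_mul (2 / √a)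
  refine hd.congr_deriv ?_
  rw [Real.sq_sqrt (by positivity), Real.sqrt_div hs.le]
  have e1 : 1 + (cosh r - 1 - a) / a = (cosh r - 1) / a := by field_simp; ring
  rw [e1]
  have p1 := Real.sqrt_pos.2 ha
  have p2 := Real.sqrt_pos.2 hs
  have e2 := Real.sq_sqrt ha.le
  field_simp

lemma cosh_sub_one_lt {ρ r : ℝ} (hρ : 0 < ρ) (hr : ρ < r) : cosh ρ - 1 < cosh r - 1 := by
  have := Real.cosh_lt_cosh.2 (show |ρ| < |r| by
    rwa [abs_of_pos hρ, abs_of_pos (hρ.trans hr)])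
  linarith

lemma integral_sinh_div_sqrt {ρ : ℝ} (hρ : 0 < ρ) :
    IntegrableOn (fun r => sinh r /
      ((cosh r - 1) * (√(cosh r - 1) * √(cosh r - cosh ρ)))) (Ioi ρ) ∧
    ∫ r in Ioi ρ, sinh r / ((cosh r - 1) * (√(cosh r - 1) * √(cosh r - cosh ρ)))
      = 2 / (cosh ρ - 1) := by
  have ha : 0 < cosh ρ - 1 := sub_pos.2 (Real.one_lt_cosh.2 hρ.ne')
  have hc : ContinuousWithinAt
      (fun r => 2 / (cosh ρ - 1) * √(1 - (cosh ρ - 1) / (cosh r - 1))) (Ici ρ) ρ := by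
    refine ContinuousAt.continuousWithinAt ?_
    refine continuousAt_const.mul (Real.continuous_sqrt.continuousAt.comp ?_)
    exact continuousAt_const.sub (continuousAt_const.div
      (by fun_prop) ha.ne')
  have hd : ∀ r ∈ Ioi ρ, HasDerivAt
      (fun r => 2 / (cosh ρ - 1) * √(1 - (cosh ρ - 1) / (cosh r - 1)))
      (sinh r / ((cosh r - 1) * (√(cosh r - 1) * √(cosh r - cosh ρ)))) r := by
    intro r hr
    have := hasDerivAt_sqrt_one_sub_div_cosh ha (cosh_sub_one_lt hρ hr)
    rwa [sub_sub_sub_cancel_right] at this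
  have hp : ∀ r ∈ Ioi ρ,
      0 ≤ sinh r / ((cosh r - 1) * (√(cosh r - 1) * √(cosh r - cosh ρ))) := by
    intro r hr
    have h1 := Real.sinh_nonneg_iff.2 (hρ.trans hr).le
    have h2 := cosh_sub_one_lt hρ hr
    have h3 : 0 ≤ cosh r - 1 := by linarith
    positivity
  have hl : Tendsto (fun r => 2 / (cosh ρ - 1) * √(1 - (cosh ρ - 1) / (cosh r - 1))) atTop
      (𝓝 (2 / (cosh ρ - 1) * √(1 - 0))) := by
    refine Tendsto.const_mul _ (Tendsto.sqrt (tendsto_const_nhds.sub ?_))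
    exact tendsto_const_nhds.div_atTop
      (tendsto_atTop_add_const_right _ _ Real.tendsto_cosh_atTop_atTop)
  refine ⟨integrableOn_Ioi_deriv_of_nonneg hc hd hp hl, ?_⟩
  rw [integral_Ioi_of_hasDerivAt_of_nonneg hc hd hp hl]
  simp [ha.ne']

lemma integral_sinh_div_sqrt' {ρ : ℝ} (hρ : 0 < ρ) :
    IntegrableOn (fun r => sinh r / ((cosh r - 1) * √(cosh r - cosh ρ))) (Ioi ρ) ∧
    ∫ r in Ioi ρ, sinh r / ((cosh r - 1) * √(cosh r - cosh ρ)) = π / √(cosh ρ - 1) := by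
  have ha : 0 < cosh ρ - 1 := sub_pos.2 (Real.one_lt_cosh.2 hρ.ne')
  have hc : ContinuousWithinAt (fun r => 2 / √(cosh ρ - 1) *
      arctan √((cosh r - 1 - (cosh ρ - 1)) / (cosh ρ - 1))) (Ici ρ) ρ := by
    refine Continuous.continuousWithinAt ?_
    refine continuous_const.mul (Real.continuous_arctan.comp (Real.continuous_sqrt.comp ?_))
    fun_prop
  have hd : ∀ r ∈ Ioi ρ, HasDerivAt (fun r => 2 / √(cosh ρ - 1) *
      arctan √((cosh r - 1 - (cosh ρ - 1)) / (cosh ρ - 1)))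
      (sinh r / ((cosh r - 1) * √(cosh r - cosh ρ))) r := by
    intro r hr
    have := hasDerivAt_arctan_sqrt_cosh ha (cosh_sub_one_lt hρ hr)
    rwa [sub_sub_sub_cancel_right (cosh r)] at this
  have hp : ∀ r ∈ Ioi ρ, 0 ≤ sinh r / ((cosh r - 1) * √(cosh r - cosh ρ)) := by
    intro r hr
    have h1 := Real.sinh_nonneg_iff.2 (hρ.trans hr).le
    have h2 := cosh_sub_one_lt hρ hr
    have h3 : 0 ≤ cosh r - 1 := by linarith
    positivity
  have hl : Tendsto (fun r => 2 / √(cosh ρ - 1) *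
      arctan √((cosh r - 1 - (cosh ρ - 1)) / (cosh ρ - 1))) atTop
      (𝓝 (2 / √(cosh ρ - 1) * (π / 2))) := by
    refine Tendsto.const_mul _ ((tendsto_arctan_atTop.mono_right nhdsWithin_le_nhds).comp
      (Real.tendsto_sqrt_atTop.comp (Tendsto.atTop_div_const ha ?_)))
    exact tendsto_atTop_add_const_right _ _
      (tendsto_atTop_add_const_right _ _ Real.tendsto_cosh_atTop_atTop)
  refine ⟨integrableOn_Ioi_deriv_of_nonneg hc hd hp hl, ?_⟩
  rw [integral_Ioi_of_hasDerivAt_of_nonneg hc hd hp hl]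
  simp

/-- Pointwise comparison of the Green kernel integrand with integrands having elementary
primitives. -/
lemma cosh_div_le {ρ r : ℝ} (hρ : 0 < ρ) (hr : ρ < r) :
    cosh r / (sinh r ^ 2 * √(cosh r - cosh ρ)) ≤
        1 / (2 * √2) * (sinh r / ((cosh r - 1) * (√(cosh r - 1) * √(cosh r - cosh ρ))) +
          sinh r / ((cosh r - 1) * √(cosh r - cosh ρ))) ∧
      cosh r / (sinh r ^ 2 * √(cosh r - cosh ρ)) ≤
        1 / √2 * (sinh r / ((cosh r - 1) * (√(cosh r - 1) * √(cosh r - cosh ρ)))) := by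
  have ha : 0 < cosh ρ - 1 := sub_pos.2 (Real.one_lt_cosh.2 hρ.ne')
  have h2 := cosh_sub_one_lt hρ hr
  have hw : 0 < cosh r - 1 := by linarith
  have hs : 0 < √(cosh r - cosh ρ) := Real.sqrt_pos.2 (by linarith)
  have hp := Real.sqrt_pos.2 hw
  have ep := Real.sq_sqrt hw.le
  have hv := Real.sqrt_pos.2 (show 0 < cosh r + 1 by linarith)
  have ev := Real.sq_sqrt (show 0 ≤ cosh r + 1 by linarith)
  have hsinh : sinh r = √(cosh r - 1) * √(cosh r + 1) := by
    rw [← Real.sqrt_mul hw.le, eq_comm, Real.sqrt_eq_iff_mul_self_eq_of_pos]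
    · have := Real.cosh_sq r
      linarith
    · exact Real.sinh_pos_iff.2 (hρ.trans hr)
  have hv2 : √2 ≤ √(cosh r + 1) := Real.sqrt_le_sqrt (by linarith)
  have h2p : 0 < √2 := by positivity
  have e2 := Real.sq_sqrt (show (0:ℝ) ≤ 2 by norm_num)
  have hcr : cosh r = √(cosh r - 1) ^ 2 + 1 := by linarith
  rw [hsinh]
  generalize √(cosh r - cosh ρ) = s at *
  have hvp : √(cosh r + 1) ^ 2 = √(cosh r - 1) ^ 2 + 2 := by linarith
  generalize √(cosh r - 1) = p at *
  rw [← ep]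
  generalize √(cosh r + 1) = v at *
  generalize √2 = q at *
  rw [hcr]
  have e1 : (p ^ 2 + 1) / ((p * v) ^ 2 * s) = (p ^ 2 + 1) / (v ^ 2) * (1 / (p ^ 2 * s)) := by
    field_simp
  constructor
  · have e3 : 1 / (2 * q) * (p * v / (p ^ 2 * (p * s)) + p * v / (p ^ 2 * s)) =
        v * (1 + p) / (2 * q) * (1 / (p ^ 2 * s)) := by
      field_simp
    rw [e1, e3]
    refine mul_le_mul_of_nonneg_right ?_ (by positivity)
    rw [div_le_div_iff₀ (by positivity) (by positivity)]
    have k1 : 2 * (p ^ 2 + 1) ≤ (p ^ 2 + 2) * (1 + p) := by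
      nlinarith [mul_pos hp hp, mul_nonneg hp.le (sq_nonneg (p - 1))]
    calc (p ^ 2 + 1) * (2 * q) = 2 * (p ^ 2 + 1) * q := by ring
      _ ≤ (p ^ 2 + 2) * (1 + p) * v := by gcongr
      _ = v * (1 + p) * v ^ 2 := by rw [hvp]; ring
  · have e3 : 1 / q * (p * v / (p ^ 2 * (p * s))) = v / q * (1 / (p ^ 2 * s)) := by
      field_simp
    rw [e1, e3]
    refine mul_le_mul_of_nonneg_right ?_ (by positivity)
    rw [div_le_div_iff₀ (by positivity) (by positivity)]
    rw [hvp, mul_comm v]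
    gcongr
    linarith

lemma integral_green_le {ρ : ℝ} (hρ : 0 < ρ) :
    ∫ r in Ioi ρ, cosh r / (sinh r ^ 2 * √(cosh r - cosh ρ)) ≤
        1 / (2 * √2) * (2 / (cosh ρ - 1) + π / √(cosh ρ - 1)) ∧
      ∫ r in Ioi ρ, cosh r / (sinh r ^ 2 * √(cosh r - cosh ρ)) ≤
        1 / √2 * (2 / (cosh ρ - 1)) := by
  obtain ⟨i1, v1⟩ := integral_sinh_div_sqrt hρ
  obtain ⟨i2, v2⟩ := integral_sinh_div_sqrt' hρ
  have h0 : 0 ≤ᵐ[volume.restrict (Ioi ρ)]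
      fun r => cosh r / (sinh r ^ 2 * √(cosh r - cosh ρ)) :=
    Eventually.of_forall fun r => div_nonneg (cosh_pos r).le (by positivity)
  constructor
  · rw [← v1, ← v2, ← integral_add i1 i2, ← integral_const_mul]
    exact integral_mono_of_nonneg h0 ((i1.add i2).const_mul _)
      ((ae_restrict_mem measurableSet_Ioi).mono fun r hr => (cosh_div_le hρ hr).1)
  · rw [← v1, ← integral_const_mul]
    exact integral_mono_of_nonneg h0 (i1.const_mul _)
      ((ae_restrict_mem measurableSet_Ioi).mono fun r hr => (cosh_div_le hρ hr).2)

lemma G1_nonneg (ρ : ℝ) : 0 ≤ G1 ρ :=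
  mul_nonneg (by positivity)
    (integral_nonneg fun r => div_nonneg (cosh_pos r).le (by positivity))

/-- The hyperbolic volume of the geodesic ball of radius `ρ`, in terms of `a = cosh ρ - 1`. -/
noncomputable def hypBallVol (a : ℝ) : ℝ := 2 * π ^ 2 / 3 * (a ^ 2 * (a + 3))

lemma hypBallVol_pos {a : ℝ} (ha : 0 < a) : 0 < hypBallVol a := by
  unfold hypBallVol; positivity

lemma hypBallVol_mono {a b : ℝ} (ha : 0 ≤ a) (hab : a ≤ b) : hypBallVol a ≤ hypBallVol b := by
  unfold hypBallVol; gcongr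

lemma green_arith {a q I : ℝ} (ha : 0 < a) (hq : 0 < q) (hqa : q ^ 4 = hypBallVol a)
    (h1 : I ≤ 1 / (2 * √2) * (2 / a + π / √a)) (h2 : I ≤ 1 / √2 * (2 / a)) :
    I * q ^ 2 ≤ π * (1 + 10 * q) := by
  have hπ := Real.pi_gt_three
  have hπ2 : π ^ 2 ≤ 10 := by nlinarith [Real.pi_lt_d2]
  have hπ3 : 9 ≤ π ^ 2 := by nlinarith
  have e2 := Real.sq_sqrt (show (0:ℝ) ≤ 2 by norm_num)
  have h2p : 1 ≤ √2 := Real.one_le_sqrt.2 (by norm_num)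
  have h2q : √2 ≤ 2 := by nlinarith
  unfold hypBallVol at hqa
  rcases le_total a 1 with h | h
  · set b := √a with hb
    have hbp : 0 < b := Real.sqrt_pos.2 ha
    have eb : b ^ 2 = a := Real.sq_sqrt ha.le
    have k1 : q ≤ 3 * b := by
      refine le_of_pow_le_pow_left₀ (n := 4) (by norm_num) (by positivity) ?_
      calc q ^ 4 = 2 * π ^ 2 / 3 * (a ^ 2 * (a + 3)) := hqa
        _ ≤ 2 * 10 / 3 * (a ^ 2 * (1 + 3)) := by gcongr
        _ ≤ 81 * a ^ 2 := by nlinarith [sq_nonneg a]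
        _ = (3 * b) ^ 4 := by rw [← eb]; ring
    have k2 : a ≤ q := by
      refine le_of_pow_le_pow_left₀ (n := 4) (by norm_num) hq.le ?_
      calc a ^ 4 = a ^ 2 * (a * a) := by ring
        _ ≤ a ^ 2 * (1 * 1) := by gcongr
        _ ≤ 2 * 9 / 3 * (a ^ 2 * (0 + 3)) := by nlinarith [sq_nonneg a]
        _ ≤ 2 * π ^ 2 / 3 * (a ^ 2 * (a + 3)) := by gcongr
        _ = q ^ 4 := hqa.symm
    have k3 : q ^ 2 ≤ √2 * π * a * (1 + a / 3) := by
      refine le_of_pow_le_pow_left₀ (n := 2) (by norm_num) (by positivity) ?_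
      calc (q ^ 2) ^ 2 = 2 * π ^ 2 * a ^ 2 * (1 + a / 3) := by rw [← pow_mul, hqa]; ring
        _ ≤ 2 * π ^ 2 * a ^ 2 * ((1 + a / 3) * (1 + a / 3)) := by
          gcongr
          nlinarith
        _ = (√2 * π * a * (1 + a / 3)) ^ 2 := by
          rw [mul_pow, mul_pow, mul_pow, e2]; ring
    calc I * q ^ 2 ≤ 1 / (2 * √2) * (2 / a + π / b) * q ^ 2 := by gcongr
      _ = 1 / (√2 * a) * q ^ 2 + π / (2 * √2 * b) * q * q := by field_simp
      _ ≤ 1 / (√2 * a) * (√2 * π * a * (1 + a / 3)) + π / (2 * √2 * b) * (3 * b) * q := by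
        gcongr
      _ = π * (1 + a / 3) + π * (3 / (2 * √2)) * q := by field_simp
      _ ≤ π * (1 + q / 3) + π * (3 / (2 * 1)) * q := by gcongr
      _ ≤ π * (1 + 10 * q) := by nlinarith [mul_pos Real.pi_pos hq]
  · have k1 : q ≤ 3 * a := by
      refine le_of_pow_le_pow_left₀ (n := 4) (by norm_num) (by positivity) ?_
      calc q ^ 4 = 2 * π ^ 2 / 3 * (a ^ 2 * (a * 1 + 3 * (1 * 1))) := by rw [hqa]; ring
        _ ≤ 2 * 10 / 3 * (a ^ 2 * (a * a + 3 * (a * a))) := by gcongr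
        _ ≤ (3 * a) ^ 4 := by nlinarith [sq_nonneg (a ^ 2)]
    calc I * q ^ 2 ≤ 1 / √2 * (2 / a) * q ^ 2 := by gcongr
      _ ≤ 1 / 1 * (2 / a) * q ^ 2 := by gcongr
      _ = 2 / a * q * q := by ring
      _ ≤ 2 / a * (3 * a) * q := by gcongr
      _ = 6 * q := by field_simp; ring
      _ ≤ π * (1 + 10 * q) := by nlinarith

/-- The claimed upper bound for the rearrangement. -/
noncomputable def greenBound (t : ℝ) : ℝ :=
  (1 / (4 * Real.sqrt 2 * π * Real.sqrt t)) * (1 + 10 * t ^ ((1 : ℝ) / 4))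

lemma sqrt_eq_rpow_quarter_sq {t : ℝ} (ht : 0 ≤ t) : √t = (t ^ ((1 : ℝ) / 4)) ^ 2 := by
  rw [Real.sqrt_eq_rpow, ← Real.rpow_natCast, ← Real.rpow_mul ht]
  norm_num

lemma greenBound_eq {t : ℝ} (ht : 0 ≤ t) : greenBound t =
    1 / (4 * √2 * π) * ((1 / t ^ ((1 : ℝ) / 4)) ^ 2 + 10 * (1 / t ^ ((1 : ℝ) / 4))) := by
  unfold greenBound
  rw [sqrt_eq_rpow_quarter_sq ht]
  rcases eq_or_ne (t ^ ((1 : ℝ) / 4)) 0 with h | h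
  · rw [h]
    simp
  · field_simp

lemma greenBound_anti {s t : ℝ} (hs : 0 < s) (hst : s ≤ t) : greenBound t ≤ greenBound s := by
  rw [greenBound_eq hs.le, greenBound_eq (hs.le.trans hst)]
  have := Real.rpow_pos_of_pos hs (1 / 4)
  have h0 : 0 ≤ t := hs.le.trans hst
  gcongr

lemma G1_le_greenBound {ρ : ℝ} (hρ : 0 < ρ) :
    G1 ρ ≤ greenBound (hypBallVol (cosh ρ - 1)) := by
  have ha : 0 < cosh ρ - 1 := sub_pos.2 (Real.one_lt_cosh.2 hρ.ne')
  have hV := hypBallVol_pos ha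
  obtain ⟨h1, h2⟩ := integral_green_le hρ
  have hq := Real.rpow_pos_of_pos hV (1 / 4)
  have hq4 : (hypBallVol (cosh ρ - 1) ^ ((1 : ℝ) / 4)) ^ 4 = hypBallVol (cosh ρ - 1) := by
    rw [← Real.rpow_natCast, ← Real.rpow_mul hV.le]
    norm_num
  have := green_arith ha hq hq4 h1 h2
  unfold G1 greenBound
  rw [sqrt_eq_rpow_quarter_sq hV.le]
  generalize hypBallVol (cosh ρ - 1) ^ ((1 : ℝ) / 4) = q at *
  generalize ∫ r in Ioi ρ, cosh r / (sinh r ^ 2 * √(cosh r - cosh ρ)) = I at *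
  calc 1 / (4 * √2 * π ^ 2) * I = 1 / (4 * √2 * π ^ 2 * q ^ 2) * (I * q ^ 2) := by field_simp
    _ ≤ 1 / (4 * √2 * π ^ 2 * q ^ 2) * (π * (1 + 10 * q)) := by gcongr
    _ = 1 / (4 * √2 * π * q ^ 2) * (1 + 10 * q) := by field_simp

lemma cosh_rhyp_sub_one {x : E4} (hx : ‖x‖ < 1) :
    cosh (rhyp x) - 1 = 2 * ‖x‖ ^ 2 / (1 - ‖x‖ ^ 2) := by
  have h0 := norm_nonneg x
  have h1 : 0 < 1 - ‖x‖ := by linarith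
  have h2 : 1 - ‖x‖ ^ 2 ≠ 0 := by nlinarith
  unfold rhyp
  rw [Real.cosh_log (by positivity)]
  field_simp
  ring

lemma rhyp_pos {x : E4} (h0 : 0 < ‖x‖) (hx : ‖x‖ < 1) : 0 < rhyp x := by
  refine Real.log_pos ?_
  rw [one_lt_div (by linarith)]
  linarith

lemma hasDerivAt_hypBallVol {r : ℝ} (hr : r ^ 2 < 1) :
    HasDerivAt (fun r => hypBallVol (2 * r ^ 2 / (1 - r ^ 2)))
      (2 * π ^ 2 * (r ^ 3 * (2 / (1 - r ^ 2)) ^ 4)) r := by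
  have h : 1 - r ^ 2 ≠ 0 := by linarith
  have hd : HasDerivAt (fun r : ℝ => 2 * r ^ 2 / (1 - r ^ 2)) (4 * r / (1 - r ^ 2) ^ 2) r := by
    refine (((hasDerivAt_pow 2 r).const_mul 2).div ((hasDerivAt_pow 2 r).const_sub 1)
      h).congr_deriv ?_
    congr 1
    norm_num
    ring
  refine (((hd.pow 2).mul (hd.add_const 3)).const_mul (2 * π ^ 2 / 3)).congr_deriv ?_
  simp
  field_simp
  ring

lemma integral_ball_E4 {f : ℝ → ℝ} (R : ℝ) (hR : 0 ≤ R) :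
    ∫ x in Metric.ball (0 : E4) R, f ‖x‖ = 2 * π ^ 2 * ∫ y in (0 : ℝ)..R, y ^ 3 * f y := by
  have h1 : ∫ x in Metric.ball (0 : E4) R, f ‖x‖ = ∫ x : E4, (Iio R).indicator f ‖x‖ := by
    rw [← integral_indicator measurableSet_ball]
    congr 1 with x
    simp [indicator]
  have hv : (volume : Measure E4).real (Metric.ball 0 1) = π ^ 2 / 2 := by
    rw [Measure.real, InnerProductSpace.volume_ball_of_dim_even (k := 2) (by simp)]
    simp
    positivity
  have h2 : ∀ y ∈ Ioi (0 : ℝ), y ^ (4 - 1) • (Iio R).indicator f y =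
      (Iio R).indicator (fun y => y ^ 3 * f y) y := by
    intro y _
    by_cases hy : y < R <;> simp [hy]
  rw [h1, integral_fun_norm_addHaar, hv, finrank_euclideanSpace_fin,
    setIntegral_congr_fun measurableSet_Ioi h2, setIntegral_indicator measurableSet_Iio,
    Ioi_inter_Iio, intervalIntegral.integral_of_le hR, integral_Ioc_eq_integral_Ioo]
  simp only [nsmul_eq_mul, smul_eq_mul]
  push_cast
  ring

lemma hypVol_ball {R : ℝ} (hR : 0 ≤ R) (hR1 : R < 1) :
    hypVol (Metric.ball 0 R) = ENNReal.ofReal (hypBallVol (2 * R ^ 2 / (1 - R ^ 2))) := by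
  have hsub : ∀ y ∈ Icc 0 R, y ^ 2 < 1 := fun y hy => by nlinarith [hy.1, hy.2]
  have hcont : ContinuousOn (fun y : ℝ => y ^ 3 * (2 / (1 - y ^ 2)) ^ 4) (Icc 0 R) := by
    refine ContinuousOn.mul (by fun_prop) (ContinuousOn.pow (ContinuousOn.div (by fun_prop)
      (by fun_prop) fun y hy => ?_) 4)
    have := hsub y hy
    linarith
  have hint : IntegrableOn (fun x : E4 => (2 / (1 - ‖x‖ ^ 2)) ^ 4) (Metric.ball 0 R) := by
    refine (integrableOn_fun_norm_addHaar volume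
      (f := fun y : ℝ => (2 / (1 - y ^ 2)) ^ 4)).2 ?_
    rw [finrank_euclideanSpace_fin]
    exact (hcont.integrableOn_Icc).mono_set Ioo_subset_Icc_self
  have hval := integral_ball_E4 (f := fun y : ℝ => (2 / (1 - y ^ 2)) ^ 4) R hR
  have hftc : ∫ y in (0 : ℝ)..R, 2 * π ^ 2 * (y ^ 3 * (2 / (1 - y ^ 2)) ^ 4) =
      hypBallVol (2 * R ^ 2 / (1 - R ^ 2)) - hypBallVol (2 * 0 ^ 2 / (1 - 0 ^ 2)) := by
    refine intervalIntegral.integral_eq_sub_of_hasDerivAt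
      (f := fun r => hypBallVol (2 * r ^ 2 / (1 - r ^ 2))) (fun y hy => ?_) ?_
    · rw [uIcc_of_le hR] at hy
      exact hasDerivAt_hypBallVol (hsub y hy)
    · refine ContinuousOn.intervalIntegrable ?_
      rw [uIcc_of_le hR]
      exact continuousOn_const.mul hcont
  rw [intervalIntegral.integral_const_mul] at hftc
  rw [hypVol, withDensity_apply _ measurableSet_ball, Measure.restrict_restrict measurableSet_ball,
    inter_eq_left.2 (Metric.ball_subset_ball hR1.le),
    ← ofReal_integral_eq_lintegral_ofReal hint (Eventually.of_forall fun x => by positivity),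
    hval, hftc]
  simp [hypBallVol]

lemma hypVol_compl_ball : hypVol (Metric.ball 0 1)ᶜ = 0 := by
  rw [hypVol, withDensity_apply _ measurableSet_ball.compl,
    Measure.restrict_restrict measurableSet_ball.compl, compl_inter_self]
  simp

lemma exists_radius {t : ℝ} (ht : 0 < t) :
    ∃ R : ℝ, 0 < R ∧ R < 1 ∧ hypBallVol (2 * R ^ 2 / (1 - R ^ 2)) = t := by
  have hc : Continuous hypBallVol := by unfold hypBallVol; fun_prop
  have h0 : hypBallVol 0 = 0 := by simp [hypBallVol]
  have h1 : t ≤ hypBallVol (t + 1) := by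
    unfold hypBallVol
    have hπ := Real.pi_gt_three
    calc t ≤ 2 * 3 ^ 2 / 3 * ((0 + 1) ^ 2 * (t + 1 + 3)) := by nlinarith
      _ ≤ 2 * π ^ 2 / 3 * ((t + 1) ^ 2 * (t + 1 + 3)) := by gcongr
  obtain ⟨a, ha, hat⟩ := intermediate_value_Icc (by linarith : (0 : ℝ) ≤ t + 1)
    hc.continuousOn ⟨h0.le.trans ht.le, h1⟩
  have ha0 : 0 < a := ha.1.lt_of_ne (by rintro rfl; linarith)
  have hsq : √(a / (a + 2)) ^ 2 = a / (a + 2) := Real.sq_sqrt (by positivity)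
  refine ⟨√(a / (a + 2)), by positivity, ?_, ?_⟩
  · rw [Real.sqrt_lt' one_pos, one_pow, div_lt_one (by positivity)]
    linarith
  · rw [hsq, ← hat]
    congr 1
    have : 1 - a / (a + 2) = 2 / (a + 2) := by field_simp; ring
    rw [this]
    field_simp

theorem G1_rearrangement_estimate :
    ∃ A₁ : ℝ, 0 < A₁ ∧ ∀ t : ℝ, 0 < t →
      rearr (fun x => G1 (rhyp x)) t
        ≤ (1 / (4 * Real.sqrt 2 * π * Real.sqrt t)) * (1 + A₁ * t ^ ((1 : ℝ) / 4)) := by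
  refine ⟨10, by norm_num, fun t ht => ?_⟩
  change _ ≤ greenBound t
  obtain ⟨R, hR, hR1, hRt⟩ := exists_radius ht
  refine csInf_le ⟨0, fun s hs => hs.1.le⟩ ⟨by unfold greenBound; positivity, ?_⟩
  have hsub : {x : E4 | greenBound t < |G1 (rhyp x)|} ⊆
      Metric.ball 0 R ∪ (Metric.ball 0 1)ᶜ := by
    intro x hx
    by_contra hcon
    simp only [mem_union, Metric.mem_ball, dist_zero_right, mem_compl_iff, not_or, not_lt,
      not_le] at hcon
    obtain ⟨hRx, hx1⟩ := hcon
    have hρ := rhyp_pos (hR.trans_le hRx) hx1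
    have hR2 : 0 < 1 - R ^ 2 := by nlinarith
    have hx2 : 0 < 1 - ‖x‖ ^ 2 := by nlinarith [norm_nonneg x]
    have hV : t ≤ hypBallVol (cosh (rhyp x) - 1) := by
      rw [cosh_rhyp_sub_one hx1, ← hRt]
      exact hypBallVol_mono (by positivity) (by gcongr)
    have := (G1_le_greenBound hρ).trans (greenBound_anti ht hV)
    rw [mem_ofPred_eq, abs_of_nonneg (G1_nonneg _)] at hx
    linarith
  calc hypVol {x : E4 | greenBound t < |G1 (rhyp x)|}
      ≤ hypVol (Metric.ball 0 R) + hypVol (Metric.ball 0 1)ᶜ :=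
        (measure_mono hsub).trans (measure_union_le _ _)
    _ = ENNReal.ofReal t := by
        rw [hypVol_compl_ball, add_zero, hypVol_ball hR.le hR1, hRt]
end
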